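/- arXiv:1007.2694 — 3 statements merged into one kernel-verified Lean document; each statement's English description precedes it below -/
import Mathlib

section
/- Every hierarchical CSR game with sum utilities has a pure Nash equilibrium. That is: if the access cost function d of a CSR game with sum utilities is symmetric (d(i,j) = d(j,i) for all i,j) and is an ultrametric (d(i,k) ≤ max(d(i,j), d(j,k)) for all i,j,k), then there exists a placement P : V → 𝒪 that is a pure Nash equilibrium. -/
open Finset

/-- Access cost of node `i` for object `α` under placement `P`:
the minimum of the server cost `D` and the distances to nodes holding `α`. -/
noncomputable def accessCost {V O : Type*} [Fintype V] [DecidableEq O]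
    (d : V → V → ℝ) (D : ℝ) (P : V → O) (i : V) (α : O) : ℝ :=
  haveI := Classical.decEq ℝ
  (insert D ((Finset.univ.filter (fun j => P j = α)).image (d i))).min'
    (Finset.insert_nonempty _ _)

/-- Total cost of node `i` under placement `P` (sum utilities). -/
noncomputable def nodeCost {V O : Type*} [Fintype V] [Fintype O] [DecidableEq O]
    (d : V → V → ℝ) (r : V → O → ℝ) (D : ℝ) (P : V → O) (i : V) : ℝ :=
  ∑ α : O, r i α * accessCost d D P i α

open Classical in
/-- Distance from `k` to the nearest copy of `γ`, among the fictional copies in `S` and the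
nodes other than `k` holding `γ`, capped by `D`. -/
noncomputable def csrDel {V O : Type*} [Fintype V] (d : V → V → ℝ) (D : ℝ)
    (S : Finset (V × O)) (P : V → O) (k : V) (γ : O) : ℝ :=
  (Finset.univ.filter (fun y => (y, γ) ∈ S ∨ (y ≠ k ∧ P y = γ))).fold min D (d k)

theorem le_csrDel {V O : Type*} [Fintype V] (d : V → V → ℝ) (D : ℝ)
    (S : Finset (V × O)) (P : V → O) (k : V) (γ : O) (x : ℝ) :
    x ≤ csrDel d D S P k γ ↔
      x ≤ D ∧ ∀ y, ((y, γ) ∈ S ∨ (y ≠ k ∧ P y = γ)) → x ≤ d k y := by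
  classical
  unfold csrDel
  rw [Finset.le_fold_min]
  simp

/-- Equilibrium in the presence of fictional copies `S`. -/
def csrEq {V O : Type*} [Fintype V] (d : V → V → ℝ) (r : V → O → ℝ) (D : ℝ)
    (S : Finset (V × O)) (P : V → O) : Prop :=
  ∀ k γ, r k γ * csrDel d D S P k γ ≤ r k (P k) * csrDel d D S P k (P k)

theorem csrStep {V O : Type*} [Fintype V] [DecidableEq V] [DecidableEq O]
    (d : V → V → ℝ) (r : V → O → ℝ) (D : ℝ)
    (hd_nonneg : ∀ i j, 0 ≤ d i j) (hd_diag : ∀ i, d i i = 0)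
    (hr_nonneg : ∀ i α, 0 ≤ r i α) (hD : ∀ i j, d i j ≤ D)
    (hsym : ∀ i j, d i j = d j i)
    (hultra : ∀ i j k, d i k ≤ max (d i j) (d j k))
    (S : Finset (V × O)) (P : V → O) (i : V) (α : O)
    (hE : csrEq d r D (insert (i, α) S) P) (hN : ¬ csrEq d r D S P) :
    ∃ (P' : V → O) (j : V) (β : O), csrEq d r D (insert (j, β) S) P' ∧
      ∑ k, r k (P k) * csrDel d D (insert (i, α) S) P k (P k) <
      ∑ k, r k (P' k) * csrDel d D (insert (j, β) S) P' k (P' k) := by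
  have hD0 : ∀ k : V, 0 ≤ D := fun k => (hd_nonneg k k).trans (hD k k)
  have hpos : ∀ (S : Finset (V × O)) P k γ, 0 ≤ csrDel d D S P k γ := by
    intro S P k γ
    rw [le_csrDel]
    exact ⟨hD0 k, fun y _ => hd_nonneg k y⟩
  -- effect of the extra copy at `i`
  have hEα : ∀ k, csrDel d D (insert (i, α) S) P k α = min (csrDel d D S P k α) (d k i) := by
    intro k
    apply eq_of_forall_le_iff
    intro x
    simp only [le_min_iff, le_csrDel, Finset.mem_insert, Prod.mk.injEq]
    grind
  have hEne : ∀ k γ, γ ≠ α → csrDel d D (insert (i, α) S) P k γ = csrDel d D S P k γ := by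
    intro k γ hγ
    apply eq_of_forall_le_iff
    intro x
    simp only [le_csrDel, Finset.mem_insert, Prod.mk.injEq]
    grind
  have hmono : ∀ k γ, csrDel d D (insert (i, α) S) P k γ ≤ csrDel d D S P k γ := by
    intro k γ
    by_cases h : γ = α
    · subst h; rw [hEα]; exact min_le_left _ _
    · rw [hEne k γ h]
  -- the set of nodes that want to move
  let B : Finset V := Finset.univ.filter (fun j =>
    r j (P j) * csrDel d D S P j (P j) < r j α * csrDel d D S P j α)
  have hB : B.Nonempty := by
    unfold csrEq at hN
    push Not at hN
    obtain ⟨j, γ, hj⟩ := hN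
    have hγ : γ = α := by
      by_contra hγ
      have h1 := hE j γ
      rw [hEne j γ hγ] at h1
      have h2 := mul_le_mul_of_nonneg_left (hmono j (P j)) (hr_nonneg j (P j))
      linarith
    subst hγ
    exact ⟨j, by simp [B, hj]⟩
  obtain ⟨j, hjB, hjmin⟩ := B.exists_min_image (fun j => d i j) hB
  have hj : r j (P j) * csrDel d D S P j (P j) < r j α * csrDel d D S P j α := by
    simpa [B] using hjB
  have hnot : ∀ k, d i k < d i j →
      r k α * csrDel d D S P k α ≤ r k (P k) * csrDel d D S P k (P k) := by
    intro k hk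
    by_contra hc
    have := hjmin k (by simpa [B] using hc)
    linarith
  have hβ : P j ≠ α := by
    intro h; rw [h] at hj; exact lt_irrefl _ hj
  have hji : d j i < csrDel d D S P j α := by
    by_contra hc
    have h1 := hE j α
    rw [hEα, hEne j _ hβ, min_eq_left (not_lt.mp hc)] at h1
    linarith
  have hne : ∀ k γ, γ ≠ α → (k ≠ j ∨ γ ≠ P j) →
      csrDel d D (insert (j, P j) S) (Function.update P j α) k γ
        = csrDel d D (insert (i, α) S) P k γ := by
    intro k γ hγ hk
    rw [hEne k γ hγ]
    apply eq_of_forall_le_iff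
    intro x
    simp only [le_csrDel, Finset.mem_insert, Prod.mk.injEq, Function.update_apply]
    grind
  have hz : csrDel d D (insert (j, P j) S) (Function.update P j α) j (P j) = 0 := by
    apply le_antisymm _ (hpos _ _ _ _)
    have := ((le_csrDel d D (insert (j, P j) S) (Function.update P j α) j (P j) _).mp
      le_rfl).2 j (Or.inl (Finset.mem_insert_self _ _))
    rwa [hd_diag] at this
  have hα : ∀ k, k ≠ j → csrDel d D (insert (j, P j) S) (Function.update P j α) k α
      = min (csrDel d D S P k α) (d k j) := by
    intro k hk
    apply eq_of_forall_le_iff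
    intro x
    simp only [le_min_iff, le_csrDel, Finset.mem_insert, Prod.mk.injEq, Function.update_apply]
    grind
  have hαj : csrDel d D (insert (j, P j) S) (Function.update P j α) j α
      = csrDel d D S P j α := by
    apply eq_of_forall_le_iff
    intro x
    simp only [le_csrDel, Finset.mem_insert, Prod.mk.injEq, Function.update_apply]
    grind
  have hhold : ∀ k, k ≠ j → P k = α → csrDel d D (insert (i, α) S) P k α ≤
      csrDel d D (insert (j, P j) S) (Function.update P j α) k α := by
    intro k hk hPk
    rw [hα k hk, hEα]
    have h1 : csrDel d D S P j α ≤ d j k :=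
      ((le_csrDel d D S P j α _).mp le_rfl).2 k (Or.inr ⟨hk, hPk⟩)
    have h2 := hultra k j i
    rw [max_eq_left (by rw [hsym k j]; linarith)] at h2
    exact min_le_min_left _ h2
  have hpay : ∀ k, k ≠ j → r k (P k) * csrDel d D (insert (i, α) S) P k (P k) ≤
      r k (P k) * csrDel d D (insert (j, P j) S) (Function.update P j α) k (P k) := by
    intro k hk
    apply mul_le_mul_of_nonneg_left _ (hr_nonneg _ _)
    by_cases h : P k = α
    · rw [h]; exact hhold k hk h
    · rw [hne k _ h (Or.inl hk)]
  have hpayj : r j (P j) * csrDel d D (insert (i, α) S) P j (P j) <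
      r j α * csrDel d D (insert (j, P j) S) (Function.update P j α) j α := by
    rw [hαj, hEne j _ hβ]; exact hj
  refine ⟨Function.update P j α, j, P j, ?_, ?_⟩
  · intro k γ
    by_cases hk : k = j
    · subst hk
      rw [Function.update_self]
      by_cases hγ : γ = α
      · rw [hγ]
      by_cases hγ' : γ = P k
      · rw [hγ', hz, mul_zero]
        exact mul_nonneg (hr_nonneg _ _) (hpos _ _ _ _)
      · rw [hne k γ hγ (Or.inr hγ')]
        exact (hE k γ).trans hpayj.le
    · rw [Function.update_of_ne hk]
      by_cases hγ : γ = α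
      · by_cases hPk : P k = α
        · rw [hγ, hPk]
        · subst hγ
          rw [hne k _ hPk (Or.inl hk), hα k hk]
          by_cases hc : d k j ≤ d k i
          · refine le_trans ?_ (hE k γ)
            rw [hEα]
            exact mul_le_mul_of_nonneg_left (min_le_min_left _ hc) (hr_nonneg _ _)
          · have hlt : d i k < d i j := by
              have h3 := hultra k i j
              rw [hsym i k]
              rcases le_max_iff.mp h3 with h | h
              · exact absurd h hc
              · linarith
            rw [hEne k _ hPk]
            exact (mul_le_mul_of_nonneg_left (min_le_left _ _) (hr_nonneg _ _)).trans
              (hnot k hlt)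
      · rw [hne k γ hγ (Or.inl hk)]
        exact (hE k γ).trans (hpay k hk)
  · apply Finset.sum_lt_sum
    · intro k _
      by_cases hk : k = j
      · subst hk
        rw [Function.update_self]; exact hpayj.le
      · rw [Function.update_of_ne hk]; exact hpay k hk
    · exact ⟨j, Finset.mem_univ _, by rw [Function.update_self]; exact hpayj⟩

theorem accessCost_update {V O : Type*} [Fintype V] [DecidableEq V] [DecidableEq O]
    (d : V → V → ℝ) (D : ℝ)
    (hd_nonneg : ∀ i j, 0 ≤ d i j) (hd_diag : ∀ i, d i i = 0) (hD : ∀ i j, d i j ≤ D)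
    (P : V → O) (i : V) (β γ : O) :
    accessCost d D (Function.update P i β) i γ =
      if γ = β then 0 else csrDel d D ∅ P i γ := by
  have h0 : 0 ≤ D := (hd_nonneg i i).trans (hD i i)
  have key : ∀ x, x ≤ accessCost d D (Function.update P i β) i γ ↔
      x ≤ D ∧ ∀ y, Function.update P i β y = γ → x ≤ d i y := by
    intro x
    unfold accessCost
    rw [Finset.le_min'_iff]
    simp
  apply eq_of_forall_le_iff
  intro x
  rw [key]
  split_ifs with h
  · constructor
    · rintro ⟨_, h2⟩
      have := h2 i (by rw [Function.update_self, h])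
      rwa [hd_diag] at this
    · intro hx
      exact ⟨hx.trans h0, fun y _ => hx.trans (hd_nonneg i y)⟩
  · simp only [le_csrDel, Function.update_apply]
    grind

theorem nodeCost_update {V O : Type*} [Fintype V] [Fintype O] [DecidableEq V] [DecidableEq O]
    (d : V → V → ℝ) (r : V → O → ℝ) (D : ℝ)
    (hd_nonneg : ∀ i j, 0 ≤ d i j) (hd_diag : ∀ i, d i i = 0) (hD : ∀ i j, d i j ≤ D)
    (P : V → O) (i : V) (β : O) :
    nodeCost d r D (Function.update P i β) i =
      ∑ γ, r i γ * csrDel d D ∅ P i γ - r i β * csrDel d D ∅ P i β := by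
  unfold nodeCost
  rw [eq_sub_iff_add_eq, ← Finset.sum_erase_add _ _ (Finset.mem_univ β),
    ← Finset.sum_erase_add _ (fun γ => r i γ * csrDel d D ∅ P i γ)
      (Finset.mem_univ β)]
  rw [accessCost_update d D hd_nonneg hd_diag hD, if_pos rfl, mul_zero, add_zero]
  congr 1
  apply Finset.sum_congr rfl
  intro γ hγ
  rw [accessCost_update d D hd_nonneg hd_diag hD, if_neg (Finset.ne_of_mem_erase hγ)]

/-- Every hierarchical CSR game with sum utilities (symmetric ultrametric access
costs) has a pure Nash equilibrium. -/
theorem hierarchical_csr_sum_has_equilibrium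
    {V O : Type*} [Fintype V] [Fintype O] [Nonempty V] [Nonempty O]
    [DecidableEq V] [DecidableEq O]
    (d : V → V → ℝ) (r : V → O → ℝ) (D : ℝ)
    (hd_nonneg : ∀ i j, 0 ≤ d i j) (hd_diag : ∀ i, d i i = 0)
    (hr_nonneg : ∀ i α, 0 ≤ r i α) (hD : ∀ i j, d i j ≤ D)
    (hsym : ∀ i j, d i j = d j i)
    (hultra : ∀ i j k, d i k ≤ max (d i j) (d j k)) :
    ∃ P : V → O, ∀ (i : V) (β : O),
      nodeCost d r D P i ≤ nodeCost d r D (Function.update P i β) i := by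
  classical
  have main : ∀ S : Finset (V × O), (∃ P, csrEq d r D S P) → ∃ P, csrEq d r D ∅ P := by
    intro S
    induction S using Finset.induction_on with
    | empty => exact id
    | insert a S ha ih =>
      rintro ⟨P, hP⟩
      apply ih
      let T : Finset ((V → O) × (V × O)) :=
        Finset.univ.filter (fun q => csrEq d r D (insert q.2 S) q.1)
      have hT : T.Nonempty := ⟨(P, a), by simp [T, hP]⟩
      obtain ⟨⟨Q, i, α⟩, hQ, hmax⟩ := T.exists_max_image
        (fun q => ∑ k, r k (q.1 k) * csrDel d D (insert q.2 S) q.1 k (q.1 k)) hT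
      refine ⟨Q, ?_⟩
      by_contra hN
      obtain ⟨P', j, β, hE, hlt⟩ := csrStep d r D hd_nonneg hd_diag hr_nonneg hD hsym hultra
        S Q i α (by simpa [T] using hQ) hN
      have := hmax (P', j, β) (by simpa [T] using hE)
      exact absurd hlt (not_lt.mpr this)
  have hstart : ∃ P, csrEq d r D (Finset.univ : Finset (V × O)) P := by
    refine ⟨fun _ => Classical.arbitrary O, fun k γ => ?_⟩
    have h0 : ∀ P : V → O, ∀ γ, csrDel d D (Finset.univ : Finset (V × O)) P k γ = 0 := by
      intro P γ
      apply le_antisymm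
      · have := ((le_csrDel d D (Finset.univ : Finset (V × O)) P k γ _).mp
          le_rfl).2 k (Or.inl (Finset.mem_univ _))
        rwa [hd_diag] at this
      · rw [le_csrDel]
        exact ⟨(hd_nonneg k k).trans (hD k k), fun y _ => hd_nonneg k y⟩
    rw [h0, h0, mul_zero, mul_zero]
  obtain ⟨P, hP⟩ := main _ hstart
  refine ⟨P, fun i β => ?_⟩
  have h1 := nodeCost_update d r D hd_nonneg hd_diag hD P i (P i)
  rw [Function.update_eq_self] at h1
  rw [h1, nodeCost_update d r D hd_nonneg hd_diag hD P i β]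
  have := hP i β
  linarith
end

section
/- Every fractional CSR game with sum utilities has a pure Nash equilibrium: there exists a fractional placement P such that for every node i and every feasible alternative strategy Q_i (i.e., Q_i : 𝒪 → [0,1] with Σ_α Q_i(α) ≤ c(i)), the total cost of i under P is at most its total cost under the placement obtained from P by replacing P_i with Q_i. -/
open Finset

/-- Access cost of node `i` for object `α` under a fractional placement `P`:
the minimum transportation cost of gathering one unit of `α` from fractions
stored at the nodes (at per-unit cost `d i j`) and at the server (cost `D`). -/
noncomputable def fracAccess {V O : Type*} [Fintype V]
    (d : V → V → ℝ) (D : ℝ) (P : V → O → ℝ) (i : V) (α : O) : ℝ :=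
  sInf {t : ℝ | ∃ (x : V → ℝ) (y : ℝ),
    (∀ j, 0 ≤ x j ∧ x j ≤ P j α) ∧ 0 ≤ y ∧ (∑ j, x j) + y = 1 ∧
    t = (∑ j, x j * d i j) + y * D}

/-- Total cost of node `i` under fractional placement `P` (sum utilities). -/
noncomputable def fracCost {V O : Type*} [Fintype V] [Fintype O]
    (d : V → V → ℝ) (r : V → O → ℝ) (D : ℝ) (P : V → O → ℝ) (i : V) : ℝ :=
  ∑ α : O, r i α * fracAccess d D P i α

/-- Scarf dominance of a finite set with respect to a family of orders. -/
def ScarfDom {Y I : Type*} (w : I → Y → ℕ) (S : Finset Y) : Prop :=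
  ∀ y, ∃ i, ∀ x ∈ S, w i y ≤ w i x

lemma scarf_half {Y I : Type*} [Fintype Y] [DecidableEq Y]
    (w : I → Y → ℕ) (hw : ∀ i, Function.Injective (w i)) (T : Finset Y)
    (hT : ScarfDom w T) (m : I → Y) (hm : ∀ i, m i ∈ T)
    (hmin : ∀ i, ∀ x ∈ T, w i (m i) ≤ w i x) (a b : I) (hab : a ≠ b) (mab : m a = m b)
    (hun : ∀ i j, i ≠ j → m i = m j → (i = a ∧ j = b) ∨ (i = b ∧ j = a))
    (hne : ∃ x, ∀ j, j ≠ a → ∃ t ∈ T, w j t < w j x) :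
    ∃ z, z ∉ T ∧ ScarfDom w (insert z T) ∧ w a z < w a (m a) ∧
      (∀ j, j ≠ a → w j (m j) < w j z) ∧
      ∀ x, x ∉ T → ScarfDom w (insert x T) → w a x < w a (m a) → x = z := by
  classical
  let M : Finset Y := univ.filter fun x => ∀ j, j ≠ a → w j (m j) < w j x
  have hMne : M.Nonempty := by
    obtain ⟨x, hx⟩ := hne
    refine ⟨x, ?_⟩
    simp only [M, mem_filter, mem_univ, true_and]
    intro j hj
    obtain ⟨t, ht, h⟩ := hx j hj
    exact (hmin j t ht).trans_lt h
  have hMlt : ∀ x, (∀ j, j ≠ a → w j (m j) < w j x) → w a x < w a (m a) := by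
    intro x hx
    obtain ⟨i, hi⟩ := hT x
    have hia : i = a := by
      by_contra h
      exact absurd (hi _ (hm i)) (not_le.mpr (hx i h))
    subst hia
    refine lt_of_le_of_ne (hi _ (hm i)) ?_
    intro h
    have := hw _ h
    have h2 := hx b hab.symm
    rw [this, mab] at h2
    exact lt_irrefl _ h2
  obtain ⟨z, hzM, hz⟩ := M.exists_max_image (w a) hMne
  have hzM' : ∀ j, j ≠ a → w j (m j) < w j z := by simpa [M] using hzM
  have hzlt := hMlt z hzM'
  refine ⟨z, ?_, ?_, hzlt, hzM', ?_⟩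
  · intro h
    exact absurd (hmin a z h) (not_le.mpr hzlt)
  · intro y
    by_cases hy : ∀ j, j ≠ a → w j (m j) < w j y
    · have hyz := hz y (by simpa [M] using hy)
      refine ⟨a, fun x hx => ?_⟩
      rcases mem_insert.mp hx with rfl | hx
      · exact hyz
      · exact hyz.trans (hzlt.le.trans (hmin a x hx))
    · push Not at hy
      obtain ⟨j, hj, hyj⟩ := hy
      refine ⟨j, fun x hx => ?_⟩
      rcases mem_insert.mp hx with rfl | hx
      · exact hyj.trans (hzM' j hj).le
      · exact hyj.trans (hmin j x hx)
  · intro x hxT hxD hxa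
    have hxM : ∀ j, j ≠ a → w j (m j) < w j x := by
      intro j hj
      obtain ⟨k, hk⟩ := hxD (m j)
      have hkx := hk x (mem_insert_self _ _)
      have hkj : m j = m k :=
        hw k (le_antisymm (hk _ (mem_insert_of_mem (hm k))) (hmin k _ (hm j)))
      have hka : k ≠ a := by
        rintro rfl
        rw [hkj] at hkx
        omega
      have : k = j := by
        by_contra h
        rcases hun k j h hkj.symm with h | h
        · exact hka h.1
        · exact hj h.2
      subst this
      refine lt_of_le_of_ne hkx fun h => ?_
      exact hxT ((hw _ h) ▸ hm k)
    obtain ⟨i, hi⟩ := hxD z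
    have hia : i = a := by
      by_contra h
      exact absurd (hi _ (mem_insert_of_mem (hm i))) (not_le.mpr (hzM' i h))
    subst hia
    exact hw i (le_antisymm (hz x (by simpa [M] using hxM)) (hi x (mem_insert_self _ _)))

lemma scarf_door_two {Y I : Type*} [Fintype Y] [DecidableEq Y] [Fintype I] [DecidableEq I]
    (w : I → Y → ℕ) (hw : ∀ i, Function.Injective (w i)) (T : Finset Y)
    (hT : ScarfDom w T) (hcard : T.card + 1 = Fintype.card I) (hTne : T.Nonempty)
    (hne : ∀ a, ∃ x, ∀ j, j ≠ a → ∃ t ∈ T, w j t < w j x)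
    [DecidablePred fun x => x ∉ T ∧ ScarfDom w (insert x T)] :
    (univ.filter fun x => x ∉ T ∧ ScarfDom w (insert x T)).card = 2 := by
  have hex : ∀ i, ∃ t ∈ T, ∀ x ∈ T, w i t ≤ w i x := fun i => T.exists_min_image (w i) hTne
  choose m hm hmin using hex
  have hsurj : ∀ t ∈ T, ∃ i, m i = t := by
    intro t ht
    obtain ⟨i, hi⟩ := hT t
    exact ⟨i, hw i (le_antisymm (hmin i t ht) (hi _ (hm i)))⟩
  obtain ⟨a, -, b, -, hab, mab⟩ := Finset.exists_ne_map_eq_of_card_lt_of_maps_to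
    (s := (univ : Finset I)) (t := T) (f := m) (by rw [card_univ]; omega) (fun i _ => hm i)
  have hinj : ∀ a b : I, a ≠ b → m a = m b → Set.InjOn m (univ.erase b : Finset I) := by
    intro a b hab mab
    apply Finset.injOn_of_card_image_eq
    have : (univ.erase b).image m = T := by
      ext t
      simp only [mem_image, mem_erase, mem_univ, and_true]
      constructor
      · rintro ⟨i, -, rfl⟩
        exact hm i
      · intro ht
        obtain ⟨i, rfl⟩ := hsurj t ht
        by_cases h : i = b
        · exact ⟨a, hab, by rw [mab, h]⟩
        · exact ⟨i, h, rfl⟩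
    rw [this, card_erase_of_mem (mem_univ _), card_univ]
    omega
  have hun : ∀ i j, i ≠ j → m i = m j → (i = a ∧ j = b) ∨ (i = b ∧ j = a) := by
    intro i j hij mij
    have h1 : ¬ (i ≠ b ∧ j ≠ b) := fun h =>
      hij (hinj a b hab mab (by simpa using h.1) (by simpa using h.2) mij)
    have h2 : ¬ (i ≠ a ∧ j ≠ a) := fun h =>
      hij (hinj b a hab.symm mab.symm (by simpa using h.1) (by simpa using h.2) mij)
    by_cases hib : i = b
    · by_cases hja : j = a
      · exact Or.inr ⟨hib, hja⟩
      · exact absurd ⟨fun h => hab (h.symm.trans hib), hja⟩ h2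
    · have hjb : j = b := by
        by_contra h
        exact h1 ⟨hib, h⟩
      by_cases hia : i = a
      · exact Or.inl ⟨hia, hjb⟩
      · exact absurd ⟨hia, fun h => hab (h.symm.trans hjb)⟩ h2
  obtain ⟨z, hz1, hz2, hz3, hz4, hz5⟩ := scarf_half w hw T hT m hm hmin a b hab mab hun (hne a)
  obtain ⟨z', hz1', hz2', hz3', hz4', hz5'⟩ := scarf_half w hw T hT m hm hmin b a hab.symm
    mab.symm (fun i j h1 h2 => (hun i j h1 h2).symm) (hne b)
  rw [Finset.card_eq_two]
  refine ⟨z, z', ?_, ?_⟩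
  · rintro rfl
    exact absurd (hz4' a hab) (not_lt.mpr hz3.le)
  · ext x
    simp only [mem_filter, mem_univ, true_and, mem_insert, mem_singleton]
    constructor
    · rintro ⟨hxT, hxD⟩
      obtain ⟨i, hi⟩ := hxD x
      have hilt : w i x < w i (m i) := by
        refine lt_of_le_of_ne (hi _ (mem_insert_of_mem (hm i))) fun h => ?_
        exact hxT (by rw [hw _ h]; exact hm i)
      obtain ⟨k, hk⟩ := hxD (m i)
      have hki : m i = m k :=
        hw k (le_antisymm (hk _ (mem_insert_of_mem (hm k))) (hmin k _ (hm i)))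
      have hik : i ≠ k := by
        rintro rfl
        exact absurd (hk x (mem_insert_self _ _)) (not_le.mpr hilt)
      rcases hun i k hik hki with ⟨rfl, rfl⟩ | ⟨rfl, rfl⟩
      · exact Or.inl (hz5 x hxT hxD hilt)
      · exact Or.inr (hz5' x hxT hxD hilt)
    · rintro (rfl | rfl)
      · exact ⟨hz1, hz2⟩
      · exact ⟨hz1', hz2'⟩

lemma scarf_room_even {Y I : Type*} [DecidableEq Y] [Fintype I] [DecidableEq I]
    (c : Y → I) (i0 : I) (S : Finset Y) (hS : S.card = Fintype.card I)
    (hc : S.image c ≠ univ) :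
    Even (S.filter fun x => (S.erase x).image c = univ.erase i0).card := by
  rcases (S.filter fun x => (S.erase x).image c = univ.erase i0).eq_empty_or_nonempty with h | h
  · rw [h]; simp
  obtain ⟨x, hx⟩ := h
  have hinj : ∀ x ∈ S, (S.erase x).image c = univ.erase i0 →
      Set.InjOn c (S.erase x : Finset Y) := by
    intro x hx h
    apply Finset.injOn_of_card_image_eq
    rw [h, card_erase_of_mem (mem_univ _), card_univ, card_erase_of_mem hx, hS]
  rw [mem_filter] at hx
  obtain ⟨hxS, hx⟩ := hx
  have himg : S.image c = insert (c x) (univ.erase i0) := by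
    rw [← hx, ← image_insert, insert_erase hxS]
  have hcx : c x ≠ i0 := by
    rintro h
    apply hc
    rw [himg, h, insert_erase (mem_univ _)]
  have : c x ∈ (S.erase x).image c := by rw [hx]; simp [hcx]
  obtain ⟨x', hx', hcc⟩ := mem_image.mp this
  have hx'S := mem_of_mem_erase hx'
  have hne : x' ≠ x := ne_of_mem_erase hx'
  have : (S.filter fun x => (S.erase x).image c = univ.erase i0) = {x, x'} := by
    ext z
    simp only [mem_filter, mem_insert, mem_singleton]
    constructor
    · rintro ⟨hz, hzi⟩
      by_contra hcon
      push Not at hcon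
      exact hne (hinj z hz hzi (by simp [hx'S, hcon.2.symm]) (by simp [hxS, hcon.1.symm]) hcc)
    · rintro (rfl | rfl)
      · exact ⟨hxS, hx⟩
      · refine ⟨hx'S, ?_⟩
        rw [← hx]
        ext i
        simp only [mem_image, mem_erase]
        constructor
        · rintro ⟨y, ⟨hy, hyS⟩, rfl⟩
          by_cases h : y = x
          · exact ⟨z, ⟨hne, hx'S⟩, by rw [h, hcc]⟩
          · exact ⟨y, ⟨h, hyS⟩, rfl⟩
        · rintro ⟨y, ⟨hy, hyS⟩, rfl⟩
          by_cases h : y = z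
          · exact ⟨x, ⟨hne.symm, hxS⟩, by rw [h, hcc]⟩
          · exact ⟨y, ⟨h, hyS⟩, rfl⟩
  rw [this, card_pair hne.symm]
  exact even_two

theorem scarf_lemma {Y I : Type*} [Fintype Y] [DecidableEq Y] [Fintype I] [DecidableEq I]
    [Nonempty I]
    (w : I → Y → ℕ) (hw : ∀ i, Function.Injective (w i)) (s : I → Y)
    (H1 : ∀ i y, w i (s i) ≤ w i y)
    (H2 : ∀ i j y, y ∉ Set.range s → i ≠ j → w i y < w i (s j))
    (hX : ∃ y, y ∉ Set.range s)
    (c : Y → I) (hcs : ∀ i, c (s i) = i) :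
    ∃ S : Finset Y, ScarfDom w S ∧ S.card = Fintype.card I ∧ S.image c = univ := by
  classical
  by_contra hcon
  push Not at hcon
  obtain ⟨i0⟩ := ‹Nonempty I›
  have hsinj : Function.Injective s := fun i j h => by rw [← hcs i, h, hcs]
  let doors : Finset (Finset Y) := univ.filter fun T =>
    ScarfDom w T ∧ T.card + 1 = Fintype.card I ∧ T.image c = univ.erase i0
  let rooms : Finset (Finset Y) := univ.filter fun S =>
    ScarfDom w S ∧ S.card = Fintype.card I
  let A := doors.sigma fun T => univ.filter fun x => x ∉ T ∧ ScarfDom w (insert x T)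
  let B := rooms.sigma fun S => S.filter fun x => (S.erase x).image c = univ.erase i0
  have hAB : A.card = B.card := by
    refine Finset.card_nbij' (fun p => ⟨insert p.2 p.1, p.2⟩) (fun p => ⟨p.1.erase p.2, p.2⟩)
      ?_ ?_ ?_ ?_
    · rintro ⟨T, x⟩ h
      simp only [A, B, doors, rooms, Finset.mem_coe, mem_sigma, mem_filter, mem_univ, true_and] at h ⊢
      obtain ⟨⟨h1, h2, h3⟩, h4, h5⟩ := h
      refine ⟨⟨h5, ?_⟩, mem_insert_self _ _, ?_⟩
      · rw [card_insert_of_notMem h4, h2]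
      · rw [erase_insert h4, h3]
    · rintro ⟨S, x⟩ h
      simp only [A, B, doors, rooms, Finset.mem_coe, mem_sigma, mem_filter, mem_univ, true_and] at h ⊢
      obtain ⟨⟨h1, h2⟩, h3, h4⟩ := h
      refine ⟨⟨?_, ?_, h4⟩, notMem_erase _ _, ?_⟩
      · intro y
        obtain ⟨i, hi⟩ := h1 y
        exact ⟨i, fun x hx => hi x (mem_of_mem_erase hx)⟩
      · rw [card_erase_add_one h3, h2]
      · rwa [insert_erase h3]
    · rintro ⟨T, x⟩ h
      simp only [A, Finset.mem_coe, mem_sigma, mem_filter, mem_univ, true_and] at h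
      simp [erase_insert h.2.1]
    · rintro ⟨S, x⟩ h
      simp only [B, Finset.mem_coe, mem_sigma, mem_filter] at h
      simp [insert_erase h.2.1]
  have hB : Even B.card := by
    rw [card_sigma]
    refine Finset.even_sum _ fun S hS => ?_
    simp only [rooms, mem_filter, mem_univ, true_and] at hS
    exact scarf_room_even c i0 S hS.2 (hcon S hS.1 hS.2)
  let T0 : Finset Y := (univ.erase i0).image s
  have hcT0 : T0.image c = univ.erase i0 := by
    have hcomp : c ∘ s = id := funext hcs
    simp only [T0]
    rw [image_image, hcomp, image_id]
  have hT0 : T0 ∈ doors := by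
    simp only [doors, mem_filter, mem_univ, true_and]
    refine ⟨?_, ?_, hcT0⟩
    · intro y
      by_cases hy : y ∈ Set.range s
      · obtain ⟨j, rfl⟩ := hy
        exact ⟨j, fun x _ => H1 j x⟩
      · refine ⟨i0, fun x hx => ?_⟩
        obtain ⟨j, hj, rfl⟩ := mem_image.mp hx
        exact (H2 i0 j y hy (ne_of_mem_erase hj).symm).le
    · rw [card_image_of_injective _ hsinj, card_erase_add_one (mem_univ _), card_univ]
  have hone : (univ.filter fun x => x ∉ T0 ∧ ScarfDom w (insert x T0)).card = 1 := by
    obtain ⟨y0, hy0⟩ := hX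
    obtain ⟨z, hz, hzmax⟩ := (univ.filter fun y => y ∉ Set.range s).exists_max_image (w i0)
      ⟨y0, by simpa using hy0⟩
    rw [mem_filter] at hz
    have hz := hz.2
    rw [card_eq_one]
    refine ⟨z, ?_⟩
    ext x
    simp only [mem_filter, mem_univ, true_and, mem_singleton]
    have hrange : ∀ x, x ∈ T0 → x ∈ Set.range s := by
      intro x hx
      obtain ⟨j, -, rfl⟩ := mem_image.mp hx
      exact ⟨j, rfl⟩
    constructor
    · rintro ⟨hxT, hxD⟩
      obtain ⟨i, hi⟩ := hxD z
      have hii : i = i0 := by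
        by_contra h
        have h1 := hi (s i) (mem_insert_of_mem (mem_image_of_mem _ (by simp [h])))
        have h2 := hw i (le_antisymm h1 (H1 i z))
        exact hz ⟨i, h2.symm⟩
      subst hii
      have hzx := hi x (mem_insert_self _ _)
      have hxr : x ∉ Set.range s := by
        rintro ⟨j, rfl⟩
        by_cases hj : j = i
        · subst hj
          exact hz ⟨j, (hw j (le_antisymm hzx (H1 j z))).symm⟩
        · exact hxT (mem_image_of_mem _ (by simp [hj]))
      exact hw i (le_antisymm (hzmax x (by simpa using hxr)) hzx)
    · rintro rfl
      refine ⟨fun h => hz (hrange _ h), fun y => ?_⟩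
      by_cases hy : y ∈ Set.range s
      · obtain ⟨j, rfl⟩ := hy
        exact ⟨j, fun x _ => H1 j x⟩
      · have hyx := hzmax y (by simpa using hy)
        refine ⟨i0, fun t ht => ?_⟩
        rcases mem_insert.mp ht with rfl | ht
        · exact hyx
        · obtain ⟨j, hj, rfl⟩ := mem_image.mp ht
          exact (H2 i0 j y hy (ne_of_mem_erase hj).symm).le
  have htwo : ∀ T ∈ doors.erase T0,
      (univ.filter fun x => x ∉ T ∧ ScarfDom w (insert x T)).card = 2 := by
    intro T hT
    obtain ⟨hTne, hT⟩ := mem_erase.mp hT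
    simp only [doors, mem_filter, mem_univ, true_and] at hT
    obtain ⟨h1, h2, h3⟩ := hT
    have : ∃ t ∈ T, t ∉ Set.range s := by
      by_contra h
      push Not at h
      apply hTne
      have : (T.image c).image s = T := by
        rw [image_image]
        ext y
        simp only [mem_image, Function.comp]
        constructor
        · rintro ⟨x, hx, rfl⟩
          obtain ⟨i, rfl⟩ := h x hx
          rwa [hcs]
        · intro hy
          obtain ⟨i, rfl⟩ := h y hy
          exact ⟨s i, hy, by rw [hcs]⟩
      rw [← this, h3]
    obtain ⟨t, ht, hts⟩ := this
    exact scarf_door_two w hw T h1 h2 ⟨t, ht⟩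
      (fun a => ⟨s a, fun j hj => ⟨t, ht, H2 j a t hts hj⟩⟩)
  have hA : A.card = (doors.erase T0).card * 2 + 1 := by
    rw [card_sigma, ← Finset.sum_erase_add _ _ hT0, hone, Finset.sum_const_nat htwo]
  rw [← hAB, hA] at hB
  obtain ⟨k, hk⟩ := hB
  omega

theorem scarf_grid {I : Type*} [Fintype I] [DecidableEq I] [Nonempty I] (N : ℕ)
    (col : (I → ℕ) → I) :
    ∃ (C : Finset I) (x : I → I → ℕ) (p : I → ℕ), ∑ j, p j = N ∧
      (∀ i ∈ C, ∑ j, x i j = N ∧ col (x i) = i ∧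
        ∀ j, x i j ≤ p j + Fintype.card I ∧ p j ≤ x i j + Fintype.card I) ∧
      ∀ j, j ∉ C → p j ≤ Fintype.card I := by
  classical
  let G := {f : I → ℕ // f ∈ Finset.piAntidiag (univ : Finset I) N}
  have hG : ∀ g : G, ∑ j, g.1 j = N := fun g => (Finset.mem_piAntidiag.mp g.2).1
  have hGle : ∀ (g : G) i, g.1 i ≤ N := fun g i => by
    exact (Finset.single_le_sum (f := g.1) (fun _ _ => Nat.zero_le _) (mem_univ i)).trans
      (hG g).le
  have mkG : ∀ f : I → ℕ, ∑ j, f j = N → ∃ g : G, g.1 = f := fun f hf =>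
    ⟨⟨f, Finset.mem_piAntidiag.mpr ⟨hf, by simp⟩⟩, rfl⟩
  let M := Fintype.card G
  let e : G ≃ Fin M := Fintype.equivFin G
  let eI : I ≃ Fin (Fintype.card I) := Fintype.equivFin I
  let w : I → G ⊕ I → ℕ := fun i y => match y with
    | Sum.inl g => g.1 i * M + (e g : ℕ) + 1
    | Sum.inr j => if i = j then 0 else (N + 1) * M + 1 + (eI j : ℕ)
  have wl : ∀ i g, w i (Sum.inl g) = g.1 i * M + (e g : ℕ) + 1 := fun _ _ => rfl
  have wr : ∀ i, w i (Sum.inr i) = 0 := fun i => if_pos rfl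
  have wr' : ∀ i j, i ≠ j → w i (Sum.inr j) = (N + 1) * M + 1 + (eI j : ℕ) :=
    fun i j h => if_neg h
  have wlt : ∀ i g, w i (Sum.inl g) < (N + 1) * M + 1 := by
    intro i g
    rw [wl]
    have h1 := Nat.mul_le_mul_right M (hGle g i)
    have h2 := (e g).isLt
    have h3 : (N + 1) * M = N * M + M := by ring
    omega
  have hw : ∀ i, Function.Injective (w i) := by
    intro i y y' h
    rcases y with g | j <;> rcases y' with g' | j'
    · rw [wl, wl] at h
      have h1 : g.1 i * M + (e g : ℕ) = g'.1 i * M + (e g' : ℕ) := by omega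
      have h2 := congrArg (· % M) h1
      simp only [Nat.mul_add_mod_self_right, Nat.mod_eq_of_lt (e g).isLt,
        Nat.mod_eq_of_lt (e g').isLt] at h2
      rw [e.injective (Fin.ext h2)]
    · exfalso
      have := wlt i g
      by_cases hj : i = j'
      · subst hj; rw [wr, wl] at h; omega
      · rw [wr' i j' hj] at h; omega
    · exfalso
      have := wlt i g'
      by_cases hj : i = j
      · subst hj; rw [wr, wl] at h; omega
      · rw [wr' i j hj] at h; omega
    · by_cases hj : i = j <;> by_cases hj' : i = j'
      · rw [← hj, ← hj']
      · exfalso; subst hj; rw [wr, wr' i j' hj'] at h; omega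
      · exfalso; subst hj'; rw [wr, wr' i j hj] at h; omega
      · rw [wr' i j hj, wr' i j' hj'] at h
        have : (eI j : ℕ) = eI j' := by omega
        rw [eI.injective (Fin.ext this)]
  have i0 : I := Classical.arbitrary I
  obtain ⟨g0, -⟩ := mkG (fun j => if j = i0 then N else 0) (by simp)
  let c : G ⊕ I → I := Sum.elim (fun g => col g.1) id
  obtain ⟨S, hD, hcard, himg⟩ := scarf_lemma w hw Sum.inr
    (fun i y => by rw [wr]; exact Nat.zero_le _)
    (fun i j y hy hij => by
      rcases y with g | k
      · have := wlt i g
        rw [wr' i j hij]; omega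
      · exact absurd ⟨k, rfl⟩ hy)
    ⟨Sum.inl g0, by simp⟩ c (fun i => rfl)
  let C : Finset I := univ.filter fun i => Sum.inr i ∉ S
  have hex : ∀ i, ∃ g : G, i ∈ C → Sum.inl g ∈ S ∧ col g.1 = i := by
    intro i
    by_cases hi : i ∈ C
    · have : i ∈ S.image c := by rw [himg]; exact mem_univ _
      obtain ⟨y, hy, hyi⟩ := mem_image.mp this
      rcases y with g | k
      · exact ⟨g, fun _ => ⟨hy, hyi⟩⟩
      · exfalso
        have : k = i := hyi
        subst this
        exact (mem_filter.mp hi).2 hy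
    · exact ⟨g0, fun h => absurd h hi⟩
  choose x hx using hex
  have hdom : ∀ g : G, ∃ i ∈ C, ∀ k ∈ C, g.1 i ≤ (x k).1 i := by
    intro g
    obtain ⟨i, hi⟩ := hD (Sum.inl g)
    refine ⟨i, ?_, ?_⟩
    · simp only [C, mem_filter, mem_univ, true_and]
      intro h
      have := hi _ h
      rw [wr, wl] at this
      omega
    · intro k hk
      have := hi _ (hx k hk).1
      rw [wl, wl] at this
      by_contra hlt
      push Not at hlt
      have h1 := Nat.mul_le_mul_right M (Nat.succ_le_of_lt hlt)
      have h2 := (e (x k)).isLt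
      have h3 : ((x k).1 i).succ * M = (x k).1 i * M + M := by rw [Nat.succ_mul]
      omega
  obtain ⟨k0, hk0, -⟩ := hdom g0
  have hmex : ∀ j, ∃ k ∈ C, ∀ l ∈ C, (x k).1 j ≤ (x l).1 j := fun j =>
    C.exists_min_image (fun k => (x k).1 j) ⟨k0, hk0⟩
  choose κ hκC hκ using hmex
  let m : I → ℕ := fun j => if j ∈ C then (x (κ j)).1 j else 0
  have hmle : ∀ k ∈ C, ∀ j, m j ≤ (x k).1 j := by
    intro k hk j
    simp only [m]
    split_ifs
    · exact hκ j k hk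
    · exact Nat.zero_le _
  have hmsum : N ≤ ∑ j, m j + Fintype.card I := by
    by_contra hlt
    push Not at hlt
    let q : I → ℕ := fun j => if j ∈ C then m j + 1 else 0
    have hq : ∑ j, q j ≤ ∑ j, m j + Fintype.card I := by
      have : ∑ j, q j ≤ ∑ j, (m j + 1) := Finset.sum_le_sum fun j _ => by
        simp only [q]; split_ifs <;> omega
      rw [Finset.sum_add_distrib] at this
      simpa using this
    obtain ⟨g, hg⟩ := mkG (fun j => q j + if j = k0 then N - ∑ j, q j else 0) (by
      rw [Finset.sum_add_distrib]
      simp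
      omega)
    obtain ⟨i, hi, h⟩ := hdom g
    have h1 := h _ (hκC i)
    rw [hg] at h1
    simp only [q, m, if_pos hi] at h1
    omega
  have hup : ∀ k ∈ C, ∀ j, (x k).1 j ≤ m j + Fintype.card I := by
    intro k hk j
    have h1 := hG (x k)
    rw [← Finset.add_sum_erase _ _ (mem_univ j)] at h1 hmsum
    have h2 : ∑ l ∈ univ.erase j, m l ≤ ∑ l ∈ univ.erase j, (x k).1 l :=
      Finset.sum_le_sum fun l _ => hmle k hk l
    omega
  refine ⟨C, fun i => (x i).1, (x k0).1, hG _, ?_, ?_⟩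
  · intro i hi
    refine ⟨hG _, (hx i hi).2, fun j => ?_⟩
    have h1 := hup i hi j
    have h2 := hup k0 hk0 j
    have h3 := hmle i hi j
    have h4 := hmle k0 hk0 j
    constructor
    · show (x i).1 j ≤ _
      omega
    · show _ ≤ (x i).1 j + _
      omega
  · intro j hj
    have h2 := hup k0 hk0 j
    simp only [m, if_neg hj] at h2
    omega

theorem simplex_variational {I : Type*} [Fintype I] [DecidableEq I] [Nonempty I]
    (ψ : I → (I → ℝ) → ℝ) (hψ : ∀ k, ContinuousOn (ψ k) (stdSimplex ℝ I))
    (h : ∀ l ∈ stdSimplex ℝ I, ∑ k, l k * ψ k l ≤ 0) :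
    ∃ l ∈ stdSimplex ℝ I, ∀ k, ψ k l ≤ 0 := by
  have hcpt : IsCompact (stdSimplex ℝ I) := isCompact_stdSimplex ℝ I
  have hne : (stdSimplex ℝ I).Nonempty := ⟨_, single_mem_stdSimplex ℝ (Classical.arbitrary I)⟩
  have key : ∀ ε > 0, ∃ l ∈ stdSimplex ℝ I, ∀ k, ψ k l ≤ 3 * ε := by
    intro ε hε
    let Ψ : (I → ℝ) → I → ℝ := fun l k => ψ k l
    have hΨ : ContinuousOn Ψ (stdSimplex ℝ I) := continuousOn_pi.mpr hψ
    obtain ⟨δ, hδ, hu⟩ := Metric.uniformContinuousOn_iff.mp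
      (hcpt.uniformContinuousOn_of_continuous hΨ) ε hε
    obtain ⟨B, hB⟩ := hcpt.exists_bound_of_continuousOn hΨ
    have hB' : ∀ l ∈ stdSimplex ℝ I, ∀ k, |ψ k l| ≤ B := fun l hl k =>
      (norm_le_pi_norm (Ψ l) k).trans (hB l hl)
    have hB0 : 0 ≤ B := (norm_nonneg _).trans (hB _ hne.some_mem)
    set n : ℝ := (Fintype.card I : ℝ) with hn
    have hn0 : 0 ≤ n := Nat.cast_nonneg _
    obtain ⟨N, hN⟩ := exists_nat_gt (max (n / δ) (n * n * (2 * B) / ε))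
    have hN1 : n / δ < N := (le_max_left _ _).trans_lt hN
    have hN2 : n * n * (2 * B) / ε < N := (le_max_right _ _).trans_lt hN
    have hNpos : (0 : ℝ) < N := (by positivity : 0 ≤ n / δ).trans_lt hN1
    have hnN : n / N < δ := by
      rw [div_lt_iff₀ hδ] at hN1
      rw [div_lt_iff₀ hNpos]
      linarith
    have hnN2 : n * (n / N * (2 * B)) ≤ ε := by
      rw [div_lt_iff₀ hε] at hN2
      have : n * (n / N * (2 * B)) = n * n * (2 * B) / N := by ring
      rw [this, div_le_iff₀ hNpos]
      linarith
    let sc : (I → ℕ) → I → ℝ := fun f i => (f i : ℝ) / N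
    have hsc : ∀ f : I → ℕ, ∑ j, f j = N → sc f ∈ stdSimplex ℝ I := by
      intro f hf
      refine ⟨fun i => by positivity, ?_⟩
      simp only [sc]
      rw [← Finset.sum_div, ← Nat.cast_sum, hf, div_self hNpos.ne']
    have hcol : ∀ f : I → ℕ, ∃ k, ∀ j, ψ j (sc f) ≤ ψ k (sc f) := fun f =>
      Finite.exists_max fun k => ψ k (sc f)
    choose col hcol using hcol
    obtain ⟨C, x, p, hp, hx, hpC⟩ := scarf_grid N col
    have hpS := hsc p hp
    refine ⟨sc p, hpS, fun j => ?_⟩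
    have hterm : ∀ k, sc p k * (ψ j (sc p) - ψ k (sc p)) ≤
        sc p k * (2 * ε) + n / N * (2 * B) := by
      intro k
      have hpk : 0 ≤ sc p k := hpS.1 k
      have hnn : 0 ≤ n / N * (2 * B) := by positivity
      by_cases hk : k ∈ C
      · obtain ⟨h1, h2, h3⟩ := hx k hk
        have hd : dist (sc (x k)) (sc p) < δ := by
          refine lt_of_le_of_lt ?_ hnN
          rw [dist_pi_le_iff (by positivity)]
          intro i
          rw [Real.dist_eq]
          simp only [sc]
          rw [← sub_div, abs_div, abs_of_pos hNpos]
          gcongr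
          obtain ⟨h4, h5⟩ := h3 i
          have h4' : (x k i : ℝ) ≤ p i + n := by rw [hn]; exact_mod_cast h4
          have h5' : (p i : ℝ) ≤ x k i + n := by rw [hn]; exact_mod_cast h5
          rw [abs_le]
          constructor <;> linarith
        have hdd := hu _ (hsc _ h1) _ hpS hd
        have hj := (dist_le_pi_dist (Ψ (sc (x k))) (Ψ (sc p)) j).trans_lt hdd
        have hk' := (dist_le_pi_dist (Ψ (sc (x k))) (Ψ (sc p)) k).trans_lt hdd
        rw [Real.dist_eq, abs_lt] at hj hk'
        have hm := hcol (x k) j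
        rw [h2] at hm
        simp only [Ψ] at hj hk'
        have : ψ j (sc p) - ψ k (sc p) ≤ 2 * ε := by linarith
        have := mul_le_mul_of_nonneg_left this hpk
        linarith
      · have h1 : sc p k ≤ n / N := by
          simp only [sc]
          gcongr
          rw [hn]
          exact_mod_cast hpC k hk
        have h2 := abs_le.mp (hB' _ hpS j)
        have h3 := abs_le.mp (hB' _ hpS k)
        have h4 : ψ j (sc p) - ψ k (sc p) ≤ 2 * B := by linarith
        have h5 := mul_le_mul_of_nonneg_left h4 hpk
        have h6 := mul_le_mul_of_nonneg_right h1 (by positivity : 0 ≤ 2 * B)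
        have h7 : 0 ≤ sc p k * (2 * ε) := by positivity
        linarith
    have hsum := Finset.sum_le_sum fun k (_ : k ∈ (univ : Finset I)) => hterm k
    simp only [mul_sub, Finset.sum_sub_distrib, Finset.sum_add_distrib, ← Finset.sum_mul,
      hpS.2, one_mul, Finset.sum_const, card_univ, nsmul_eq_mul] at hsum
    have := h _ hpS
    rw [← hn] at hsum
    linarith
  have hcont : ContinuousOn (fun l => univ.sup' univ_nonempty fun k => ψ k l)
      (stdSimplex ℝ I) := ContinuousOn.finset_sup'_apply _ fun k _ => hψ k
  obtain ⟨l, hl, hmin⟩ := hcpt.exists_isMinOn hne hcont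
  refine ⟨l, hl, fun k => ?_⟩
  refine le_of_forall_pos_le_add fun ε hε => ?_
  obtain ⟨l', hl', hk'⟩ := key (ε / 3) (by positivity)
  have h1 : ψ k l ≤ univ.sup' univ_nonempty fun k => ψ k l :=
    Finset.le_sup' (fun k => ψ k l) (mem_univ k)
  have h2 := hmin hl'
  simp only [Set.mem_ofPred_eq] at h2
  have h3 : (univ.sup' univ_nonempty fun k => ψ k l') ≤ ε :=
    Finset.sup'_le _ _ fun k _ => (hk' k).trans (by linarith)
  linarith

/-- Ky Fan type variational inequality. -/
theorem kyfan_exists {E : Type*} [NormedAddCommGroup E] [NormedSpace ℝ E] (K : Set E)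
    (hK : IsCompact K) (hKc : Convex ℝ K) (hKne : K.Nonempty) (φ : E → E → ℝ)
    (hcont : ∀ Q ∈ K, ContinuousOn (fun P => φ P Q) K)
    (hconc : ∀ P ∈ K, ConcaveOn ℝ K (φ P)) (hdiag : ∀ P ∈ K, φ P P ≤ 0) :
    ∃ P ∈ K, ∀ Q ∈ K, φ P Q ≤ 0 := by
  classical
  have := hK.inter_iInter_nonempty (fun Q : K => K ∩ (fun P => φ P Q) ⁻¹' Set.Iic 0)
    (fun Q => (hcont Q Q.2).preimage_isClosed_of_isClosed hK.isClosed isClosed_Iic) (by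
      intro u
      rcases u.eq_empty_or_nonempty with rfl | hu
      · simpa using hKne
      have : Nonempty u := hu.to_subtype
      let f : (u → ℝ) → E := fun l => ∑ k : u, l k • (k.1.1 : E)
      have hf : ∀ l ∈ stdSimplex ℝ u, f l ∈ K := fun l hl =>
        hKc.sum_mem (fun k _ => hl.1 k) hl.2 fun k _ => k.1.2
      have hfc : Continuous f := by fun_prop
      obtain ⟨l, hl, hk⟩ := simplex_variational (fun (k : u) l => φ (f l) k.1.1)
        (fun k => (hcont _ k.1.2).comp hfc.continuousOn hf) (by
          intro l hl
          have h1 := (hconc (f l) (hf l hl)).le_map_sum (t := univ) (w := l)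
            (p := fun k : u => (k.1.1 : E)) (fun k _ => hl.1 k) hl.2 (fun k _ => k.1.2)
          exact h1.trans (hdiag _ (hf l hl)))
      refine ⟨f l, hf l hl, ?_⟩
      simp only [Set.mem_iInter]
      intro Q hQ
      exact ⟨hf l hl, hk ⟨Q, hQ⟩⟩)
  obtain ⟨P, hP, hPQ⟩ := this
  refine ⟨P, hP, fun Q hQ => ?_⟩
  exact (Set.mem_iInter.mp hPQ ⟨Q, hQ⟩).2

lemma fracAccess_bdd {V O : Type*} [Fintype V]
    (d : V → V → ℝ) (D : ℝ) (hd : ∀ i j, 0 ≤ d i j) (hD0 : 0 ≤ D)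
    (P : V → O → ℝ) (i : V) (α : O) :
    BddBelow {t : ℝ | ∃ (x : V → ℝ) (y : ℝ),
    (∀ j, 0 ≤ x j ∧ x j ≤ P j α) ∧ 0 ≤ y ∧ (∑ j, x j) + y = 1 ∧
    t = (∑ j, x j * d i j) + y * D} := by
  refine ⟨0, ?_⟩
  rintro t ⟨x, y, h1, h2, h3, rfl⟩
  exact add_nonneg (Finset.sum_nonneg fun j _ => mul_nonneg (h1 j).1 (hd i j))
    (mul_nonneg h2 hD0)

lemma fracAccess_le {V O : Type*} [Fintype V]
    (d : V → V → ℝ) (D : ℝ) (hd : ∀ i j, 0 ≤ d i j) (hD0 : 0 ≤ D)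
    (P : V → O → ℝ) (i : V) (α : O) (x : V → ℝ) (y : ℝ)
    (h1 : ∀ j, 0 ≤ x j ∧ x j ≤ P j α) (h2 : 0 ≤ y) (h3 : (∑ j, x j) + y = 1) :
    fracAccess d D P i α ≤ (∑ j, x j * d i j) + y * D :=
  csInf_le (fracAccess_bdd d D hd hD0 P i α) ⟨x, y, h1, h2, h3, rfl⟩

lemma fracAccess_approx {V O : Type*} [Fintype V]
    (d : V → V → ℝ) (D : ℝ) (P : V → O → ℝ) (hP : ∀ i α, 0 ≤ P i α) (i : V) (α : O)
    (ε : ℝ) (hε : 0 < ε) :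
    ∃ (x : V → ℝ) (y : ℝ),
      (∀ j, 0 ≤ x j ∧ x j ≤ P j α) ∧ 0 ≤ y ∧ (∑ j, x j) + y = 1 ∧
      (∑ j, x j * d i j) + y * D < fracAccess d D P i α + ε := by
  obtain ⟨t, ⟨x, y, h1, h2, h3, rfl⟩, ht⟩ := Real.lt_sInf_add_pos (s := {t : ℝ | ∃ (x : V → ℝ) (y : ℝ),
    (∀ j, 0 ≤ x j ∧ x j ≤ P j α) ∧ 0 ≤ y ∧ (∑ j, x j) + y = 1 ∧
    t = (∑ j, x j * d i j) + y * D})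
    ⟨_, fun _ => 0, 1, fun j => ⟨le_rfl, hP j α⟩, zero_le_one, by simp, rfl⟩ hε
  exact ⟨x, y, h1, h2, h3, ht⟩

lemma fracAccess_convex {V O : Type*} [Fintype V]
    (d : V → V → ℝ) (D : ℝ) (hd : ∀ i j, 0 ≤ d i j) (hD0 : 0 ≤ D)
    (P P' : V → O → ℝ) (hP : ∀ i α, 0 ≤ P i α) (hP' : ∀ i α, 0 ≤ P' i α) (i : V) (α : O)
    (a b : ℝ) (ha : 0 ≤ a) (hb : 0 ≤ b) (hab : a + b = 1) :
    fracAccess d D (a • P + b • P') i α ≤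
      a * fracAccess d D P i α + b * fracAccess d D P' i α := by
  refine le_of_forall_pos_le_add fun ε hε => ?_
  obtain ⟨x, y, h1, h2, h3, h4⟩ := fracAccess_approx d D P hP i α ε hε
  obtain ⟨x', y', h1', h2', h3', h4'⟩ := fracAccess_approx d D P' hP' i α ε hε
  have := fracAccess_le d D hd hD0 (a • P + b • P') i α (fun j => a * x j + b * x' j)
    (a * y + b * y') (fun j => ⟨add_nonneg (mul_nonneg ha (h1 j).1) (mul_nonneg hb (h1' j).1), by
      simp only [Pi.add_apply, Pi.smul_apply, smul_eq_mul]
      exact add_le_add (mul_le_mul_of_nonneg_left (h1 j).2 ha)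
        (mul_le_mul_of_nonneg_left (h1' j).2 hb)⟩)
    (by positivity) (by
      rw [Finset.sum_add_distrib, ← Finset.mul_sum, ← Finset.mul_sum]
      linear_combination a * h3 + b * h3' + hab)
  refine this.trans ?_
  have e1 : ∑ j, (a * x j + b * x' j) * d i j =
      a * ∑ j, x j * d i j + b * ∑ j, x' j * d i j := by
    rw [Finset.mul_sum, Finset.mul_sum, ← Finset.sum_add_distrib]
    exact Finset.sum_congr rfl fun j _ => by ring
  rw [e1]
  have g1 := mul_le_mul_of_nonneg_left h4.le ha
  have g2 := mul_le_mul_of_nonneg_left h4'.le hb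
  have g3 : ε = a * ε + b * ε := by rw [← add_mul, hab, one_mul]
  linarith

lemma fracAccess_lip {V O : Type*} [Fintype V]
    (d : V → V → ℝ) (D : ℝ) (hd : ∀ i j, 0 ≤ d i j) (hD0 : 0 ≤ D)
    (P P' : V → O → ℝ) (hP : ∀ i α, 0 ≤ P i α) (hP' : ∀ i α, 0 ≤ P' i α) (i : V) (α : O) :
    fracAccess d D P' i α ≤ fracAccess d D P i α + D * ∑ j, |P' j α - P j α| := by
  refine le_of_forall_pos_le_add fun ε hε => ?_
  obtain ⟨x, y, h1, h2, h3, h4⟩ := fracAccess_approx d D P hP i α ε hε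
  have hle : ∑ j, min (x j) (P' j α) ≤ ∑ j, x j := Finset.sum_le_sum fun j _ => min_le_left _ _
  have := fracAccess_le d D hd hD0 P' i α (fun j => min (x j) (P' j α))
    (1 - ∑ j, min (x j) (P' j α)) (fun j => ⟨le_min (h1 j).1 (hP' j α), min_le_right _ _⟩)
    (by linarith) (by ring)
  have g1 : ∑ j, min (x j) (P' j α) * d i j ≤ ∑ j, x j * d i j :=
    Finset.sum_le_sum fun j _ => mul_le_mul_of_nonneg_right (min_le_left _ _) (hd i j)
  have g2 : ∑ j, x j ≤ ∑ j, min (x j) (P' j α) + ∑ j, |P' j α - P j α| := by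
    rw [← Finset.sum_add_distrib]
    refine Finset.sum_le_sum fun j _ => ?_
    have a1 := neg_abs_le (P' j α - P j α)
    have a2 := abs_nonneg (P' j α - P j α)
    have a3 := (h1 j).2
    rcases min_choice (x j) (P' j α) with h | h <;> rw [h] <;> linarith
  have g3 : (1 - ∑ j, min (x j) (P' j α)) * D ≤ (y + ∑ j, |P' j α - P j α|) * D :=
    mul_le_mul_of_nonneg_right (by linarith) hD0
  nlinarith

lemma fracAccess_cont {V O : Type*} [Fintype V] [Fintype O]
    (d : V → V → ℝ) (D : ℝ) (hd : ∀ i j, 0 ≤ d i j) (hD0 : 0 ≤ D) (i : V) (α : O) :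
    ContinuousOn (fun P : V → O → ℝ => fracAccess d D P i α) {P | ∀ i α, 0 ≤ P i α} := by
  intro P hP
  have hlim : Filter.Tendsto (fun P' : V → O → ℝ => D * ∑ j, |P' j α - P j α|)
      (nhdsWithin P {P | ∀ i α, 0 ≤ P i α}) (nhds 0) := by
    have hc : Continuous (fun P' : V → O → ℝ => D * ∑ j, |P' j α - P j α|) := by fun_prop
    have := hc.tendsto P
    simp only [sub_self, abs_zero, Finset.sum_const_zero, mul_zero] at this
    exact this.mono_left nhdsWithin_le_nhds
  unfold ContinuousWithinAt
  rw [tendsto_iff_dist_tendsto_zero]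
  refine squeeze_zero' (Filter.Eventually.of_forall fun _ => dist_nonneg) ?_ hlim
  filter_upwards [self_mem_nhdsWithin] with P' hP'
  rw [Real.dist_eq, abs_le]
  have h1 := fracAccess_lip d D hd hD0 P P' hP hP' i α
  have h2 := fracAccess_lip d D hd hD0 P' P hP' hP i α
  simp only [abs_sub_comm (P _ α) (P' _ α)] at h2
  constructor <;> linarith

/-- Placements with nonnegative entries. -/
def csrPos (V O : Type*) : Set (V → O → ℝ) := {P | ∀ i α, 0 ≤ P i α}

/-- Feasible fractional placements. -/
def csrFeas {V O : Type*} [Fintype O] (c : V → ℝ) : Set (V → O → ℝ) :=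
  {P | (∀ i α, 0 ≤ P i α ∧ P i α ≤ 1) ∧ ∀ i, ∑ α, P i α ≤ c i}

/-- Nikaido-Isoda function of the game. -/
noncomputable def csrGain {V O : Type*} [Fintype V] [Fintype O] [DecidableEq V]
    (d : V → V → ℝ) (r : V → O → ℝ) (D : ℝ) (P Q : V → O → ℝ) : ℝ :=
  ∑ i, (fracCost d r D P i - fracCost d r D (Function.update P i (Q i)) i)

lemma csrFeas_pos {V O : Type*} [Fintype O] (c : V → ℝ) :
    ∀ P ∈ csrFeas (O := O) c, P ∈ csrPos V O := fun P hP i α => (hP.1 i α).1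

lemma csrPos_update {V O : Type*} [DecidableEq V] :
    ∀ P ∈ csrPos V O, ∀ Q ∈ csrPos V O, ∀ i, Function.update P i (Q i) ∈ csrPos V O := by
  intro P hP Q hQ i j α
  by_cases h : j = i
  · subst h; simpa using hQ j α
  · rw [Function.update_of_ne h]; exact hP j α

lemma csrFeas_closed {V O : Type*} [Fintype V] [Fintype O] (c : V → ℝ) :
    IsClosed (csrFeas (O := O) c) := by
  have : csrFeas (O := O) c = (⋂ i, ⋂ α, {P : V → O → ℝ | 0 ≤ P i α ∧ P i α ≤ 1}) ∩
      ⋂ i, {P : V → O → ℝ | ∑ α, P i α ≤ c i} := by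
    ext P; simp [csrFeas]
  rw [this]
  refine IsClosed.inter (isClosed_iInter fun i => isClosed_iInter fun α => ?_)
    (isClosed_iInter fun i => ?_)
  · have hcc : Continuous fun P : V → O → ℝ => P i α := by fun_prop
    exact isClosed_Icc.preimage hcc
  · have hcc : Continuous fun P : V → O → ℝ => ∑ α, P i α := by fun_prop
    exact isClosed_Iic.preimage hcc

lemma csrFeas_compact {V O : Type*} [Fintype V] [Fintype O] (c : V → ℝ) :
    IsCompact (csrFeas (O := O) c) := by
  refine (isCompact_univ_pi fun _ : V => isCompact_univ_pi fun _ : O =>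
    isCompact_Icc (a := (0 : ℝ)) (b := 1)).of_isClosed_subset (csrFeas_closed c) ?_
  intro P hP i _ α _
  exact hP.1 i α

lemma csrFeas_convex {V O : Type*} [Fintype O] (c : V → ℝ) :
    Convex ℝ (csrFeas (O := O) c) := by
  intro P hP Q hQ a b ha hb hab
  refine ⟨fun i α => ?_, fun i => ?_⟩
  · simp only [Pi.add_apply, Pi.smul_apply, smul_eq_mul]
    have h1 := hP.1 i α
    have h2 := hQ.1 i α
    constructor
    · exact add_nonneg (mul_nonneg ha h1.1) (mul_nonneg hb h2.1)
    · have g1 := mul_le_mul_of_nonneg_left h1.2 ha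
      have g2 := mul_le_mul_of_nonneg_left h2.2 hb
      linarith
  · simp only [Pi.add_apply, Pi.smul_apply, smul_eq_mul]
    rw [Finset.sum_add_distrib, ← Finset.mul_sum, ← Finset.mul_sum]
    have g1 := mul_le_mul_of_nonneg_left (hP.2 i) ha
    have g2 := mul_le_mul_of_nonneg_left (hQ.2 i) hb
    have g3 : c i = a * c i + b * c i := by rw [← add_mul, hab, one_mul]
    linarith

lemma fracCost_cont {V O : Type*} [Fintype V] [Fintype O]
    (d : V → V → ℝ) (r : V → O → ℝ) (D : ℝ) (hd : ∀ i j, 0 ≤ d i j) (hD0 : 0 ≤ D) :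
    ∀ i, ContinuousOn (fun P : V → O → ℝ => fracCost d r D P i) (csrPos V O) := by
  intro i
  unfold fracCost
  exact continuousOn_finsetSum _ fun α _ =>
    continuousOn_const.mul (fracAccess_cont d D hd hD0 i α)

lemma csr_update_cont {V O : Type*} [DecidableEq V] (i : V) (q : O → ℝ) :
    Continuous (fun P : V → O → ℝ => Function.update P i q) := by
  refine continuous_pi fun j => ?_
  by_cases h : j = i
  · subst h
    simp only [Function.update_self]
    exact continuous_const
  · simp only [Function.update_of_ne h]
    exact continuous_apply j

lemma csrGain_cont {V O : Type*} [Fintype V] [Fintype O] [DecidableEq V]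
    (d : V → V → ℝ) (r : V → O → ℝ) (D : ℝ) (c : V → ℝ) (hd : ∀ i j, 0 ≤ d i j) (hD0 : 0 ≤ D) :
    ∀ Q ∈ csrFeas c, ContinuousOn (fun P : V → O → ℝ => csrGain d r D P Q) (csrFeas c) := by
  intro Q hQ
  have h1 : ∀ i, ContinuousOn (fun P : V → O → ℝ => fracCost d r D P i) (csrFeas c) :=
    fun i => (fracCost_cont d r D hd hD0 i).mono (csrFeas_pos c)
  have h2 : ∀ i, ContinuousOn
      (fun P : V → O → ℝ => fracCost d r D (Function.update P i (Q i)) i) (csrFeas c) := by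
    intro i
    have hm : Set.MapsTo (fun P : V → O → ℝ => Function.update P i (Q i)) (csrFeas c)
        (csrPos V O) := fun P hP =>
      csrPos_update P (csrFeas_pos c P hP) Q (csrFeas_pos c Q hQ) i
    exact ContinuousOn.comp (g := fun P : V → O → ℝ => fracCost d r D P i)
      (f := fun P : V → O → ℝ => Function.update P i (Q i)) (fracCost_cont d r D hd hD0 i)
      (csr_update_cont i (Q i)).continuousOn hm
  unfold csrGain
  exact continuousOn_finsetSum _ fun i _ => (h1 i).sub (h2 i)

lemma csrGain_concave {V O : Type*} [Fintype V] [Fintype O] [DecidableEq V]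
    (d : V → V → ℝ) (r : V → O → ℝ) (D : ℝ) (c : V → ℝ) (hd_nonneg : ∀ i j, 0 ≤ d i j)
    (hr_nonneg : ∀ i α, 0 ≤ r i α) (hD0 : 0 ≤ D) :
    ∀ P ∈ csrFeas c, ConcaveOn ℝ (csrFeas c) (csrGain (O := O) d r D P) := by
  intro P hP
  refine ⟨csrFeas_convex c, ?_⟩
  intro Q hQ Q' hQ' a b ha hb hab
  simp only [csrGain, smul_eq_mul]
  rw [Finset.mul_sum, Finset.mul_sum, ← Finset.sum_add_distrib]
  refine Finset.sum_le_sum fun i _ => ?_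
  have hu : Function.update P i ((a • Q + b • Q') i) =
      a • Function.update P i (Q i) + b • Function.update P i (Q' i) := by
    funext j α
    by_cases h : j = i
    · subst h; simp
    · simp [Function.update_of_ne h, ← add_mul, hab]
  have hle : fracCost d r D (Function.update P i ((a • Q + b • Q') i)) i ≤
      a * fracCost d r D (Function.update P i (Q i)) i +
      b * fracCost d r D (Function.update P i (Q' i)) i := by
    rw [hu]
    unfold fracCost
    rw [Finset.mul_sum, Finset.mul_sum, ← Finset.sum_add_distrib]
    refine Finset.sum_le_sum fun α _ => ?_
    have := mul_le_mul_of_nonneg_left (fracAccess_convex d D hd_nonneg hD0 _ _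
      (csrPos_update P (csrFeas_pos c P hP) Q (csrFeas_pos c Q hQ) i) (csrPos_update P (csrFeas_pos c P hP) Q' (csrFeas_pos c Q' hQ') i)
      i α a b ha hb hab) (hr_nonneg i α)
    refine this.trans (le_of_eq (by ring))
  have g3 : fracCost d r D P i = a * fracCost d r D P i + b * fracCost d r D P i := by
    rw [← add_mul, hab, one_mul]
  linarith

/-- Every fractional CSR game with sum utilities has a pure Nash equilibrium. -/
theorem fractional_csr_has_equilibrium
    {V O : Type*} [Fintype V] [Fintype O] [Nonempty V] [Nonempty O] [DecidableEq V]
    (d : V → V → ℝ) (r : V → O → ℝ) (D : ℝ) (c : V → ℝ)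
    (hd_nonneg : ∀ i j, 0 ≤ d i j) (hd_diag : ∀ i, d i i = 0)
    (hr_nonneg : ∀ i α, 0 ≤ r i α) (hD : ∀ i j, d i j ≤ D)
    (hc : ∀ i, 0 ≤ c i) :
    ∃ P : V → O → ℝ,
      (∀ i α, 0 ≤ P i α ∧ P i α ≤ 1) ∧
      (∀ i, (∑ α, P i α) ≤ c i) ∧
      ∀ (i : V) (Q : O → ℝ), (∀ α, 0 ≤ Q α ∧ Q α ≤ 1) → (∑ α, Q α) ≤ c i →
        fracCost d r D P i ≤ fracCost d r D (Function.update P i Q) i := by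
  have hD0 : 0 ≤ D := (hd_nonneg (Classical.arbitrary V) (Classical.arbitrary V)).trans (hD _ _)
  obtain ⟨P, hP, hPQ⟩ := kyfan_exists (csrFeas (O := O) c) (csrFeas_compact c) (csrFeas_convex c)
    ⟨0, fun i α => by simp, fun i => by simpa using hc i⟩ (csrGain d r D)
    (csrGain_cont d r D c hd_nonneg hD0) (csrGain_concave d r D c hd_nonneg hr_nonneg hD0)
    (by
      intro P _
      simp [csrGain])
  refine ⟨P, hP.1, hP.2, fun i Q hQ hQc => ?_⟩
  have hQK : Function.update P i Q ∈ csrFeas c := by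
    refine ⟨fun j => ?_, fun j => ?_⟩
    · by_cases h : j = i
      · subst h; simpa using hQ
      · rw [Function.update_of_ne h]; exact hP.1 j
    · by_cases h : j = i
      · subst h; simpa using hQc
      · rw [Function.update_of_ne h]; exact hP.2 j
  have := hPQ _ hQK
  simp only [csrGain] at this
  rw [Finset.sum_eq_single i] at this
  · simp only [Function.update_self] at this
    linarith
  · intro j _ hj
    rw [Function.update_of_ne hj, Function.update_eq_self, sub_self]
  · intro h
    exact absurd (mem_univ i) h
end

section
/- Every finite nonempty strongly connected digraph is 1-critical: there exist a 2-coloring c and a vertex u such that every vertex v ≠ u is stable under c. -/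
/-- There is a walk of length `n` from the vertex to `u`. -/
def WalkTo {V : Type*} (r : V → V → Prop) (u : V) : ℕ → V → Prop
  | 0, v => v = u
  | n + 1, v => ∃ w, r v w ∧ WalkTo r u n w

/-- Every finite nonempty strongly connected digraph is 1-critical: there is a
2-coloring under which every vertex, except possibly one, has an out-neighbor
of a different color. -/
theorem strongly_connected_one_critical
    {V : Type*} [Fintype V] [Nonempty V] (r : V → V → Prop)
    (hsc : ∀ u v : V, Relation.ReflTransGen r u v) :
    ∃ (c : V → Bool) (u : V), ∀ v : V, v ≠ u → ∃ w : V, r v w ∧ c w ≠ c v := by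
  classical
  obtain ⟨u⟩ := ‹Nonempty V›
  have hex : ∀ v, ∃ n, WalkTo r u n v := by
    intro v
    induction hsc v u using Relation.ReflTransGen.head_induction_on with
    | refl => exact ⟨0, rfl⟩
    | head h _ ih =>
      obtain ⟨n, hn⟩ := ih
      exact ⟨n + 1, _, h, hn⟩
  -- color by the parity of the distance to `u`
  refine ⟨fun v => decide (Nat.find (hex v) % 2 = 0), u, fun v hv => ?_⟩
  have hs := Nat.find_spec (hex v)
  rcases hd : Nat.find (hex v) with _ | n
  · rw [hd] at hs
    exact absurd hs hv
  · rw [hd] at hs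
    obtain ⟨w, hw, hn⟩ := hs
    have h1 : Nat.find (hex w) ≤ n := Nat.find_min' _ hn
    have h2 : Nat.find (hex v) ≤ Nat.find (hex w) + 1 :=
      Nat.find_min' _ ⟨w, hw, Nat.find_spec (hex w)⟩
    have h3 : Nat.find (hex w) = n := by omega
    refine ⟨w, hw, ?_⟩
    simp only [h3, hd, ne_eq, decide_eq_decide]
    omega
end
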